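/- arXiv:2605.29750 — 3 statements merged into one kernel-verified Lean document; each statement's English description precedes it below -/
import Mathlib

section
/- Let (X_g, θ_g)_{g∈Γ} be a partial action of a group Γ on a set X. Define a relation ∼ on Γ × X by (g, x) ∼ (h, y) if and only if x ∈ X_{g⁻¹h} and θ_{h⁻¹g}(x) = y. Then ∼ is an equivalence relation on Γ × X (this is the relation used to construct the globalization Y = (Γ × X)/∼ of the partial action). -/
/-- In a partial action, `θ k⁻¹` undoes `θ k` on the domain `D k⁻¹`. -/
theorem partialAction_inv_apply_apply {Γ X : Type*} [Group Γ]
    {D : Γ → Set X} {θ : Γ → X → X}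
    (hD1 : D 1 = Set.univ) (hθ1 : ∀ x : X, θ 1 x = x)
    (hPA3 : ∀ g h : Γ, ∀ x ∈ D h⁻¹ ∩ D (g * h)⁻¹, θ g (θ h x) = θ (g * h) x)
    {k : Γ} {x : X} (hx : x ∈ D k⁻¹) : θ k⁻¹ (θ k x) = x := by
  rw [hPA3 k⁻¹ k x ⟨hx, by simp [hD1]⟩, inv_mul_cancel, hθ1]

/-- In a partial action, `θ k` maps `D k⁻¹` into `D k`. -/
theorem partialAction_apply_mem {Γ X : Type*} [Group Γ]
    {D : Γ → Set X} {θ : Γ → X → X} (hD1 : D 1 = Set.univ)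
    (hPA2 : ∀ g h : Γ, θ g '' (D g⁻¹ ∩ D h) ⊆ D g ∩ D (g * h))
    {k : Γ} {x : X} (hx : x ∈ D k⁻¹) : θ k x ∈ D k :=
  (hPA2 k 1 ⟨x, ⟨hx, by simp [hD1]⟩, rfl⟩).1

/-- The relation `(g, x) ∼ (h, y) ↔ x ∈ X_{g⁻¹h} ∧ θ_{h⁻¹g}(x) = y`
used to construct the globalization of a partial action is an equivalence relation. -/
theorem partialAction_globalization_equivalence
    {Γ X : Type*} [Group Γ]
    (D : Γ → Set X) (θ : Γ → X → X)
    (hD1 : D 1 = Set.univ) (hθ1 : ∀ x : X, θ 1 x = x)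
    (hPA2 : ∀ g h : Γ, θ g '' (D g⁻¹ ∩ D h) ⊆ D g ∩ D (g * h))
    (hPA3 : ∀ g h : Γ, ∀ x ∈ D h⁻¹ ∩ D (g * h)⁻¹, θ g (θ h x) = θ (g * h) x) :
    Equivalence (fun p q : Γ × X =>
      p.2 ∈ D (p.1⁻¹ * q.1) ∧ θ (q.1⁻¹ * p.1) p.2 = q.2) := by
  refine ⟨fun p => by simp [hD1, hθ1], ?_, ?_⟩
  · rintro ⟨g, x⟩ ⟨h, y⟩ ⟨hx, hxy⟩
    dsimp only at hx hxy ⊢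
    subst hxy
    have hx' : x ∈ D (h⁻¹ * g)⁻¹ := by simpa using hx
    exact ⟨partialAction_apply_mem hD1 hPA2 hx',
      by simpa using partialAction_inv_apply_apply hD1 hθ1 hPA3 hx'⟩
  · rintro ⟨g, x⟩ ⟨h, y⟩ ⟨k, z⟩ ⟨hx, hxy⟩ ⟨hy, hyz⟩
    dsimp only at hx hxy hy hyz ⊢
    subst hxy hyz
    have hx' : x ∈ D (h⁻¹ * g)⁻¹ := by simpa using hx
    have hgk : x ∈ D (g⁻¹ * k) := by
      have hmem := (hPA2 (h⁻¹ * g)⁻¹ (h⁻¹ * k) ⟨θ (h⁻¹ * g) x,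
        ⟨by simpa using partialAction_apply_mem hD1 hPA2 hx', hy⟩, rfl⟩).2
      rw [partialAction_inv_apply_apply hD1 hθ1 hPA3 hx'] at hmem
      simpa [mul_assoc] using hmem
    refine ⟨hgk, ?_⟩
    have hcomp := hPA3 (k⁻¹ * h) (h⁻¹ * g) x ⟨hx', by simpa [mul_assoc] using hgk⟩
    simpa [mul_assoc] using hcomp.symm
end

section
/- Let Γ be a group and A a C*-algebra with a partial Γ-action given by closed two-sided ideals (A_g)_{g∈Γ} and maps θ_g : A → A restricting to *-isomorphisms A_{g⁻¹} → A_g and satisfying (PA1)–(PA3). Let H be a complex Hilbert space, π : A → B(H) a *-representation, and U : Γ → B(H) a unitary representation (each U_g unitary, U_e = 1, U_g U_h = U_{gh}) satisfying the covariance condition U_g π(a) U_{g⁻¹} = π(θ_g(a)) for all g ∈ Γ and a ∈ A_{g⁻¹}. For g ∈ Γ let P_g denote the orthogonal projection of H onto the closed linear span of {π(a)ξ : a ∈ A_g, ξ ∈ H}, and set u_g = P_g ∘ U_g. Then for all g, h ∈ Γ: (i) u_g = U_g ∘ P_{g⁻¹}; (ii) (u_g)* = u_{g⁻¹}; (iii)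 u_g is a partial isometry with (u_g)* u_g = P_{g⁻¹} and u_g (u_g)* = P_g; (iv) u_g π(a) u_{g⁻¹} = π(θ_g(a)) for all a ∈ A_{g⁻¹}; (v) π(a) ∘ (u_g u_h − u_{gh}) = 0 for all a ∈ A_g ∩ A_{gh}. -/
/-- A partial action of a group `Γ` on a C*-algebra `A`: a family of closed two-sided
ideals `D g` with `D 1 = A`, and maps `θ g` restricting to *-isomorphisms
`D g⁻¹ → D g`, satisfying the partial-action axioms (PA1)–(PA3). -/
structure CStarPartialAction (Γ A : Type*) [Group Γ] [NormedRing A] [StarRing A]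
    [Module ℂ A] where
  D : Γ → Set A
  θ : Γ → A → A
  isClosed : ∀ g : Γ, IsClosed (D g)
  zero_mem : ∀ g : Γ, (0 : A) ∈ D g
  add_mem : ∀ g : Γ, ∀ a ∈ D g, ∀ b ∈ D g, a + b ∈ D g
  mul_mem_left : ∀ g : Γ, ∀ a ∈ D g, ∀ x : A, x * a ∈ D g
  mul_mem_right : ∀ g : Γ, ∀ a ∈ D g, ∀ x : A, a * x ∈ D g
  D_one : D 1 = Set.univ
  θ_one : ∀ a : A, θ 1 a = a
  bijOn : ∀ g : Γ, Set.BijOn (θ g) (D g⁻¹) (D g)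
  map_add : ∀ g : Γ, ∀ a ∈ D g⁻¹, ∀ b ∈ D g⁻¹, θ g (a + b) = θ g a + θ g b
  map_mul : ∀ g : Γ, ∀ a ∈ D g⁻¹, ∀ b ∈ D g⁻¹, θ g (a * b) = θ g a * θ g b
  map_smul : ∀ g : Γ, ∀ c : ℂ, ∀ a ∈ D g⁻¹, θ g (c • a) = c • θ g a
  map_star : ∀ g : Γ, ∀ a ∈ D g⁻¹, θ g (star a) = star (θ g a)
  pa2 : ∀ g h : Γ, θ g '' (D g⁻¹ ∩ D h) ⊆ D g ∩ D (g * h)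
  pa3 : ∀ g h : Γ, ∀ a ∈ D h⁻¹ ∩ D (g * h)⁻¹, θ g (θ h a) = θ (g * h) a

/-- An idempotent fixes every vector of its range. -/
theorem apply_eq_self_of_mem_range_of_mul_self {H : Type*} [NormedAddCommGroup H]
    [InnerProductSpace ℂ H] {p : H →L[ℂ] H} (hp : p * p = p) {y : H}
    (hy : y ∈ Set.range p) : p y = y := by
  obtain ⟨x, rfl⟩ := hy
  exact DFunLike.congr_fun hp x

/-- If a self-adjoint `p` satisfies `p * (star x * x) = star x * x`, then `x * p = x`. -/
theorem CStarRing.mul_eq_self_of_mul_star_mul_self {B : Type*} [NormedRing B] [StarRing B]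
    [CStarRing B] {p x : B} (hp : IsSelfAdjoint p)
    (h : p * (star x * x) = star x * x) : x * p = x := by
  have h' : star x * x * p = star x * x := by
    have := congrArg star h
    simpa [hp.star_eq, mul_assoc] using this
  rw [← sub_eq_zero, ← CStarRing.star_mul_self_eq_zero_iff]
  rw [mul_assoc] at h'
  simp only [star_sub, star_mul, hp.star_eq, sub_mul, mul_sub, mul_assoc, h', h]
  simp

/-- Let a partial `Γ`-action on a C*-algebra `A` be given, let
`π : A → B(H)` be a *-representation and `U : Γ → B(H)` a unitary representation
satisfying `U_g π(a) U_{g⁻¹} = π(θ_g(a))` for `a ∈ A_{g⁻¹}`. With `P_g` the orthogonal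
projection onto the closed linear span of `π(A_g)H` and `u_g = P_g U_g`, the triple
`(π, u, H)` is a covariant representation: (i) `u_g = U_g P_{g⁻¹}`; (ii) `(u_g)* = u_{g⁻¹}`;
(iii) `u_g` is a partial isometry with `(u_g)* u_g = P_{g⁻¹}` and `u_g (u_g)* = P_g`;
(iv) `u_g π(a) u_{g⁻¹} = π(θ_g(a))` for `a ∈ A_{g⁻¹}`;
(v) `π(a)(u_g u_h − u_{gh}) = 0` for `a ∈ A_g ∩ A_{gh}`. -/
theorem covariant_representation_from_unitary
    {Γ A H : Type*} [Group Γ]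
    [NormedRing A] [StarRing A] [CStarRing A] [NormedAlgebra ℂ A] [StarModule ℂ A]
    [CompleteSpace A]
    [NormedAddCommGroup H] [InnerProductSpace ℂ H] [CompleteSpace H]
    (T : CStarPartialAction Γ A)
    (π : A →⋆ₐ[ℂ] (H →L[ℂ] H))
    (U : Γ → H →L[ℂ] H)
    (hU1 : U 1 = 1)
    (hUmul : ∀ g h : Γ, U g * U h = U (g * h))
    (hUunitary : ∀ g : Γ, star (U g) * U g = 1 ∧ U g * star (U g) = 1)
    (hcov : ∀ g : Γ, ∀ a ∈ T.D g⁻¹, U g * π a * U g⁻¹ = π (T.θ g a))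
    (P : Γ → H →L[ℂ] H)
    (hPsa : ∀ g : Γ, IsSelfAdjoint (P g))
    (hPidem : ∀ g : Γ, P g * P g = P g)
    (hPrange : ∀ g : Γ, Set.range (P g) =
      closure ((Submodule.span ℂ {y : H | ∃ a ∈ T.D g, ∃ ξ : H, π a ξ = y} : Submodule ℂ H) : Set H))
    (u : Γ → H →L[ℂ] H) (hu : ∀ g : Γ, u g = P g * U g) :
    ∀ g h : Γ,
      -- (i)
      (u g = U g * P g⁻¹) ∧
      -- (ii)
      (star (u g) = u g⁻¹) ∧
      -- (iii)
      (u g * star (u g) * u g = u g ∧ star (u g) * u g = P g⁻¹ ∧ u g * star (u g) = P g) ∧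
      -- (iv)
      (∀ a ∈ T.D g⁻¹, u g * π a * u g⁻¹ = π (T.θ g a)) ∧
      -- (v)
      (∀ a ∈ T.D g ∩ T.D (g * h), π a * (u g * u h - u (g * h)) = 0) := by
  have hstar (g : Γ) : star (U g) = U g⁻¹ := by
    calc star (U g) = star (U g) * (U g * U g⁻¹) := by
          rw [hUmul, mul_inv_cancel, hU1, mul_one]
      _ = U g⁻¹ := by rw [← mul_assoc, (hUunitary g).1, one_mul]
  have hinv (g : Γ) : U g⁻¹ * U g = 1 := by rw [hUmul, inv_mul_cancel, hU1]
  have hinv' (g : Γ) : U g * U g⁻¹ = 1 := by rw [hUmul, mul_inv_cancel, hU1]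
  have hPπ (g : Γ) (a : A) (ha : a ∈ T.D g) : P g * π a = π a := by
    ext ξ
    refine apply_eq_self_of_mem_range_of_mul_self (hPidem g) ?_
    rw [hPrange]
    exact subset_closure (Submodule.subset_span ⟨a, ha, ξ, rfl⟩)
  have hπP (g : Γ) (a : A) (ha : a ∈ T.D g) : π a * P g = π a := by
    refine CStarRing.mul_eq_self_of_mul_star_mul_self (hPsa g) ?_
    rw [← map_star, ← map_mul]
    exact hPπ g _ (T.mul_mem_left g a ha _)
  have hPUP (g : Γ) : P g * U g * P g⁻¹ = U g * P g⁻¹ := by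
    have key : ∀ y ∈ closure ((Submodule.span ℂ
        {y : H | ∃ a ∈ T.D g⁻¹, ∃ ξ : H, π a ξ = y} : Submodule ℂ H) : Set H),
        P g (U g y) = U g y := by
      intro y hy
      refine closure_minimal (t := {y | P g (U g y) = U g y}) ?_
        (isClosed_eq (by fun_prop) (by fun_prop)) hy
      intro z hz
      induction hz using Submodule.span_induction with
      | mem z hz =>
        obtain ⟨a, ha, ξ, rfl⟩ := hz
        have hmul : P g * (U g * π a) = U g * π a := by
          have : U g * π a = π (T.θ g a) * U g := by
            rw [← hcov g a ha, mul_assoc, hinv, mul_one]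
          rw [this, ← mul_assoc, hPπ g _ ((T.bijOn g).mapsTo ha)]
        exact DFunLike.congr_fun hmul ξ
      | zero => simp
      | add x y _ _ hx hy => simp_all
      | smul c x _ hx => simp_all
    ext ξ
    exact key _ (hPrange g⁻¹ ▸ Set.mem_range_self ξ)
  have hPU (g : Γ) : P g * U g = U g * P g⁻¹ := by
    have h := congrArg star (hPUP g⁻¹)
    simp only [star_mul, (hPsa _).star_eq, hstar, inv_inv] at h
    rw [← h, ← mul_assoc, hPUP]
  have hustar (g : Γ) : star (u g) = u g⁻¹ := by
    rw [hu, hu, star_mul, hstar, (hPsa g).star_eq, hPU g⁻¹, inv_inv]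
  have hmul_star (g : Γ) : u g * star (u g) = P g := by
    rw [hu, star_mul, (hPsa g).star_eq, hstar, mul_assoc, ← mul_assoc (U g), hinv', one_mul,
      hPidem]
  intro g h
  refine ⟨by rw [hu, hPU], hustar g, ⟨?_, ?_, hmul_star g⟩, ?_, ?_⟩
  · rw [hmul_star, hu, ← mul_assoc, hPidem]
  · simpa [hustar] using hmul_star g⁻¹
  · intro a ha
    rw [hu, hu, ← mul_assoc, mul_assoc (P g * U g), hπP _ a ha, mul_assoc (P g), mul_assoc (P g),
      hcov g a ha, hPπ g _ ((T.bijOn g).mapsTo ha)]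
  · rintro a ⟨hag, hagh⟩
    have hb : T.θ g⁻¹ a ∈ T.D h := by
      have := T.pa2 g⁻¹ (g * h) ⟨a, ⟨by rwa [inv_inv], hagh⟩, rfl⟩
      simpa using this.2
    have hcomm : π a * U g = U g * π (T.θ g⁻¹ a) := by
      rw [← hcov g⁻¹ a (by rwa [inv_inv]), inv_inv, ← mul_assoc, ← mul_assoc, hinv', one_mul]
    rw [mul_sub, sub_eq_zero, hu, hu, hu]
    calc π a * (P g * U g * (P h * U h)) = π a * P g * U g * P h * U h := by
          simp only [mul_assoc]
      _ = π a * U g * U h := by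
          rw [hπP g a hag, hcomm, mul_assoc (U g), hπP h _ hb]
      _ = π a * (P (g * h) * U (g * h)) := by
          rw [← mul_assoc, hπP _ a hagh, mul_assoc, hUmul]
end

section
/- For l ∈ ℕ define φ_l : ℝ → ℂ by φ_l(ξ) = (1 − iξ)^l / (1 + iξ)^{l+1}. Then for all natural numbers l ≠ m, the function ξ ↦ φ_l(ξ) · conj(φ_m(ξ)) is integrable on ℝ (with respect to Lebesgue measure) and ∫_ℝ φ_l(ξ) · conj(φ_m(ξ)) dξ = 0; that is, the family (φ_l)_{l∈ℕ} is orthogonal in L²(ℝ). -/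
open MeasureTheory

lemma one_add_I_mul_ofReal_ne_zero (ξ : ℝ) : 1 + Complex.I * (ξ : ℂ) ≠ 0 :=
  fun h => by simpa using congrArg Complex.re h

open Filter Topology Bornology in
lemma tendsto_cayley_cobounded :
    Tendsto (fun ξ : ℝ => (1 - Complex.I * ξ) / (1 + Complex.I * ξ)) (cobounded ℝ) (𝓝 (-1)) := by
  have hden : Tendsto (fun ξ : ℝ => 1 + Complex.I * (ξ : ℂ)) (cobounded ℝ) (cobounded ℂ) := by
    rw [← tendsto_norm_atTop_iff_cobounded]
    refine tendsto_atTop_mono (fun ξ => ?_) tendsto_norm_cobounded_atTop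
    simpa using Complex.abs_im_le_norm (1 + Complex.I * (ξ : ℂ))
  have h := ((tendsto_inv₀_cobounded.comp hden).const_mul 2).sub_const 1
  rw [mul_zero, zero_sub] at h
  refine h.congr fun ξ => ?_
  have hb := one_add_I_mul_ofReal_ne_zero ξ
  simp only [Function.comp_apply]
  field_simp
  ring

lemma one_sub_I_mul_ofReal_ne_zero (ξ : ℝ) : 1 - Complex.I * (ξ : ℂ) ≠ 0 :=
  fun h => by simpa using congrArg Complex.re h

lemma norm_cayley_eq_one (ξ : ℝ) : ‖(1 - Complex.I * ξ) / (1 + Complex.I * ξ)‖ = 1 := by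
  have h : 1 - Complex.I * (ξ : ℂ) = (starRingEnd ℂ) (1 + Complex.I * ξ) := by
    simp [sub_eq_add_neg]
  rw [norm_div, h, RCLike.norm_conj,
    div_self (norm_ne_zero_iff.2 (one_add_I_mul_ofReal_ne_zero ξ))]

lemma hasDerivAt_cayley_zpow (k : ℤ) (ξ : ℝ) :
    HasDerivAt (fun ξ : ℝ => ((1 - Complex.I * ξ) / (1 + Complex.I * ξ)) ^ k)
      (-2 * Complex.I * k *
        (((1 - Complex.I * ξ) / (1 + Complex.I * ξ)) ^ k * (((1 + ξ ^ 2)⁻¹ : ℝ) : ℂ))) ξ := by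
  have ha := one_sub_I_mul_ofReal_ne_zero ξ
  have hb := one_add_I_mul_ofReal_ne_zero ξ
  have hI : HasDerivAt (fun ξ : ℝ => Complex.I * (ξ : ℂ)) (Complex.I * 1) ξ :=
    (Complex.ofRealCLM.hasDerivAt (x := ξ)).const_mul Complex.I
  have hw := (hI.const_sub 1).div (hI.const_add 1) hb
  have h := (hasDerivAt_zpow k _ (Or.inl (div_ne_zero ha hb))).comp ξ hw
  refine h.congr_deriv ?_
  have hab : (1 : ℂ) + (ξ : ℂ) ^ 2 = (1 - Complex.I * ξ) * (1 + Complex.I * ξ) := by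
    linear_combination (ξ : ℂ) ^ 2 * Complex.I_sq
  push_cast
  rw [hab, zpow_sub_one₀ (div_ne_zero ha hb)]
  field_simp
  ring

lemma phi_mul_conj_phi (l m : ℕ) (ξ : ℝ) :
    ((1 - Complex.I * ξ) ^ l / (1 + Complex.I * ξ) ^ (l + 1)) *
        (starRingEnd ℂ) ((1 - Complex.I * ξ) ^ m / (1 + Complex.I * ξ) ^ (m + 1)) =
      ((1 - Complex.I * ξ) / (1 + Complex.I * ξ)) ^ ((l : ℤ) - m) *
        (((1 + ξ ^ 2)⁻¹ : ℝ) : ℂ) := by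
  have ha := one_sub_I_mul_ofReal_ne_zero ξ
  have hb := one_add_I_mul_ofReal_ne_zero ξ
  have hab : (1 : ℂ) + (ξ : ℂ) ^ 2 = (1 - Complex.I * ξ) * (1 + Complex.I * ξ) := by
    linear_combination (ξ : ℂ) ^ 2 * Complex.I_sq
  have hca : (starRingEnd ℂ) (1 - Complex.I * ξ) = 1 + Complex.I * ξ := by simp
  have hcb : (starRingEnd ℂ) (1 + Complex.I * ξ) = 1 - Complex.I * ξ := by
    simp [sub_eq_add_neg]
  rw [map_div₀, map_pow, map_pow, hca, hcb, zpow_sub₀ (div_ne_zero ha hb), zpow_natCast,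
    zpow_natCast]
  push_cast
  rw [hab, div_pow, div_pow]
  field_simp
  ring

lemma integrable_cayley_zpow_mul (k : ℤ) :
    Integrable (fun ξ : ℝ => ((1 - Complex.I * ξ) / (1 + Complex.I * ξ)) ^ k *
      (((1 + ξ ^ 2)⁻¹ : ℝ) : ℂ)) := by
  refine Integrable.bdd_mul (c := 1) integrable_inv_one_add_sq.ofReal ?_ ?_
  · exact (continuous_iff_continuousAt.2 fun ξ =>
      (hasDerivAt_cayley_zpow k ξ).continuousAt).aestronglyMeasurable
  · exact ae_of_all _ fun ξ => by rw [norm_zpow, norm_cayley_eq_one, one_zpow]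

lemma integral_cayley_zpow_mul {k : ℤ} (hk : k ≠ 0) :
    ∫ ξ : ℝ, ((1 - Complex.I * ξ) / (1 + Complex.I * ξ)) ^ k *
      (((1 + ξ ^ 2)⁻¹ : ℝ) : ℂ) = 0 := by
  have hlim := tendsto_cayley_cobounded.zpow₀ k (Or.inl (by norm_num))
  rw [IsOrderBornology.cobounded_eq, Filter.tendsto_sup] at hlim
  have h := integral_of_hasDerivAt_of_tendsto (hasDerivAt_cayley_zpow k)
    ((integrable_cayley_zpow_mul k).const_mul _) hlim.1 hlim.2
  rw [sub_self, integral_const_mul] at h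
  exact (mul_eq_zero.1 h).resolve_left (by simp [hk])

/-- The functions `φ_l(ξ) = (1 − iξ)^l / (1 + iξ)^{l+1}` form an orthogonal
family in `L²(ℝ)`: for `l ≠ m` the product `φ_l · conj(φ_m)` is integrable with integral `0`. -/
theorem phi_family_orthogonal :
    ∀ l m : ℕ, l ≠ m →
      Integrable (fun ξ : ℝ =>
        ((1 - Complex.I * ξ) ^ l / (1 + Complex.I * ξ) ^ (l + 1)) *
          (starRingEnd ℂ) ((1 - Complex.I * ξ) ^ m / (1 + Complex.I * ξ) ^ (m + 1))) ∧
      ∫ ξ : ℝ,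
          ((1 - Complex.I * ξ) ^ l / (1 + Complex.I * ξ) ^ (l + 1)) *
            (starRingEnd ℂ) ((1 - Complex.I * ξ) ^ m / (1 + Complex.I * ξ) ^ (m + 1)) = 0 := by
  intro l m hlm
  simp only [phi_mul_conj_phi]
  exact ⟨integrable_cayley_zpow_mul _,
    integral_cayley_zpow_mul (sub_ne_zero.2 (Nat.cast_injective.ne hlm))⟩
end
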